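/- Let x be a random vector in ℝ^d distributed according to the Gaussian mixture Σ_{l=1}^L λ_l N(μ_l, Σ_l). For every u ∈ ℝ^d and every integer t ≥ 1, E[⟨u, x⟩^{2t}] ≤ (2t−1)!! · ‖u‖^{2t} · Σ_{l=1}^L λ_l (‖μ_l‖ + ‖Σ_l‖^{1/2})^{2t}. -/

import Mathlib

open MeasureTheory ProbabilityTheory RealInnerProductSpace Matrix

/-- The sigmoid function `φ(x) = 1/(1 + exp(−x))`. -/
noncomputable def phi (x : ℝ) : ℝ := 1 / (1 + Real.exp (-x))

/-- The derivative of the sigmoid, `φ' = φ(1−φ)`. -/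
noncomputable def phi' (x : ℝ) : ℝ := phi x * (1 - phi x)

/-- The standard Gaussian measure on `ℝ^d` (i.i.d. `N(0,1)` coordinates). -/
noncomputable def stdGaussian (d : ℕ) : Measure (EuclideanSpace ℝ (Fin d)) :=
  (Measure.pi fun _ : Fin d => gaussianReal 0 1).map
    (WithLp.equiv 2 (Fin d → ℝ)).symm

/-- The Gaussian measure `N(μ, A·Aᵀ)` on `ℝ^d`: the law of `μ + A·z` for a
standard Gaussian vector `z`. -/
noncomputable def gaussianVec {d : ℕ} (μ : EuclideanSpace ℝ (Fin d))
    (A : Matrix (Fin d) (Fin d) ℝ) : Measure (EuclideanSpace ℝ (Fin d)) :=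
  (stdGaussian d).map (fun z => μ + Matrix.toEuclideanLin A z)

/-- The Gaussian mixture `Σ_l λ_l · N(μ_l, A_l·A_lᵀ)` on `ℝ^d`. -/
noncomputable def gaussianMixture {d L : ℕ} (lam : Fin L → ℝ)
    (μ : Fin L → EuclideanSpace ℝ (Fin d)) (A : Fin L → Matrix (Fin d) (Fin d) ℝ) :
    Measure (EuclideanSpace ℝ (Fin d)) :=
  ∑ l, ENNReal.ofReal (lam l) • gaussianVec (μ l) (A l)

/-- The spectral (operator) norm of a matrix, i.e. the operator norm of the
induced linear map between Euclidean spaces. -/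
noncomputable def specNorm {d : ℕ} (M : Matrix (Fin d) (Fin d) ℝ) : ℝ :=
  ‖LinearMap.toContinuousLinearMap (Matrix.toEuclideanLin M)‖

lemma aux_iter (n : ℕ) : iteratedDeriv (n + 2) (fun t : ℝ => Real.exp (t ^ 2 / 2)) =
    fun t => t * iteratedDeriv (n + 1) (fun t : ℝ => Real.exp (t ^ 2 / 2)) t
      + (n + 1 : ℝ) * iteratedDeriv n (fun t : ℝ => Real.exp (t ^ 2 / 2)) t := by
  have hc : ContDiff ℝ ⊤ (fun t : ℝ => Real.exp (t ^ 2 / 2)) := by fun_prop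
  have hd : ∀ k, Differentiable ℝ (iteratedDeriv k (fun t : ℝ => Real.exp (t ^ 2 / 2))) :=
    fun k => hc.differentiable_iteratedDeriv k (by exact_mod_cast WithTop.coe_lt_top _)
  have h1 : iteratedDeriv 1 (fun t : ℝ => Real.exp (t ^ 2 / 2)) =
      fun t => t * Real.exp (t ^ 2 / 2) := by
    rw [iteratedDeriv_one]
    ext t
    have : HasDerivAt (fun t : ℝ => Real.exp (t ^ 2 / 2)) (Real.exp (t ^ 2 / 2) * ((2 : ℕ) * t ^ (2 - 1) / 2)) t :=
      ((hasDerivAt_pow 2 t).div_const 2).exp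
    rw [this.deriv]; simp; ring
  induction n with
  | zero =>
    ext t
    rw [iteratedDeriv_succ]
    have h := (hasDerivAt_id t).mul ((hd 0 t).hasDerivAt)
    rw [← iteratedDeriv_succ] at h
    simp only [zero_add, iteratedDeriv_zero] at h ⊢
    rw [h1]
    refine Eq.trans h.deriv ?_
    rw [h1]; simp; ring
  | succ n ih =>
    ext t
    rw [iteratedDeriv_succ]
    have h := ((hasDerivAt_id t).mul ((hd (n+1) t).hasDerivAt)).add
      (((hd n t).hasDerivAt).const_mul (n + 1 : ℝ))
    rw [← iteratedDeriv_succ, ← iteratedDeriv_succ] at h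
    have h3 := h.deriv
    conv_lhs => rw [ih]
    refine Eq.trans h3 ?_
    push_cast; simp only [id]; ring

lemma aux_mom_rec (n : ℕ) : ∫ x, x ^ (n + 2) ∂(gaussianReal 0 1) =
    (n + 1 : ℝ) * ∫ x, x ^ n ∂(gaussianReal 0 1) := by
  have key : ∀ k : ℕ, ∫ x, x ^ k ∂(gaussianReal 0 1) =
      iteratedDeriv k (fun t : ℝ => Real.exp (t ^ 2 / 2)) 0 := by
    intro k
    have h := iteratedDeriv_mgf_zero (X := fun x : ℝ => x) (μ := gaussianReal 0 1) (by simp) k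
    rw [mgf_fun_id_gaussianReal] at h
    simpa using h.symm
  rw [key, key, aux_iter]; simp

noncomputable def dfac (t : ℕ) : ℝ := ((2 * t).factorial : ℝ) / (2 ^ t * (t.factorial : ℝ))

lemma dfac_succ (t : ℕ) : dfac (t + 1) = (2 * t + 1) * dfac t := by
  unfold dfac
  rw [show 2 * (t + 1) = 2 * t + 1 + 1 by ring, Nat.factorial_succ, Nat.factorial_succ,
    Nat.factorial_succ]
  have := Nat.factorial_ne_zero t
  push_cast
  field_simp
  ring

lemma dfac_pos (t : ℕ) : 0 < dfac t := by unfold dfac; positivity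

lemma dfac_mono : Monotone dfac := by
  apply monotone_nat_of_le_succ
  intro n
  rw [dfac_succ]
  have : (0 : ℝ) ≤ n := by positivity
  nlinarith [dfac_pos n]

lemma aux_mom (k : ℕ) : ∫ x, x ^ (2 * k) ∂(gaussianReal 0 1) = dfac k ∧
    ∫ x, x ^ (2 * k + 1) ∂(gaussianReal 0 1) = 0 := by
  induction k with
  | zero => simp [dfac]
  | succ k ih =>
    constructor
    · rw [show 2 * (k + 1) = 2 * k + 2 by ring, aux_mom_rec, ih.1, dfac_succ]; push_cast; ring
    · rw [show 2 * (k + 1) + 1 = 2 * k + 1 + 2 by ring, aux_mom_rec, ih.2, mul_zero]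

lemma aux_mom_bd (t j : ℕ) (h : j ≤ 2 * t) : 0 ≤ ∫ x, x ^ j ∂(gaussianReal 0 1) ∧
    ∫ x, x ^ j ∂(gaussianReal 0 1) ≤ dfac t := by
  obtain ⟨k, rfl | rfl⟩ := Nat.even_or_odd' j
  · rw [(aux_mom k).1]; exact ⟨(dfac_pos k).le, dfac_mono (by omega)⟩
  · rw [(aux_mom k).2]; exact ⟨le_rfl, (dfac_pos t).le⟩

lemma aux_int (n : ℕ) : Integrable (fun x : ℝ => x ^ n) (gaussianReal 0 1) := by
  have h := (memLp_id_gaussianReal (μ := 0) (v := 1) n).integrable_norm_pow'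
  rw [← integrable_norm_iff (by fun_prop)]
  simpa using h

lemma aux_1d (a s : ℝ) (hs : 0 ≤ s) (t : ℕ) :
    Integrable (fun x : ℝ => (a + s * x) ^ (2 * t)) (gaussianReal 0 1) ∧
    ∫ x, (a + s * x) ^ (2 * t) ∂(gaussianReal 0 1) ≤ dfac t * (|a| + s) ^ (2 * t) := by
  have e : (fun x : ℝ => (a + s * x) ^ (2 * t)) = fun x => ∑ m ∈ Finset.range (2 * t + 1),
      (s ^ m * a ^ (2 * t - m) * ((2 * t).choose m : ℝ)) * x ^ m := by
    ext x
    rw [add_comm a, add_pow]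
    refine Finset.sum_congr rfl fun m _ => ?_
    rw [mul_pow]; ring
  have hi : ∀ m ∈ Finset.range (2 * t + 1), Integrable (fun x : ℝ =>
      (s ^ m * a ^ (2 * t - m) * ((2 * t).choose m : ℝ)) * x ^ m) (gaussianReal 0 1) :=
    fun m _ => (aux_int m).const_mul _
  rw [e]
  refine ⟨integrable_finsetSum _ hi, ?_⟩
  rw [integral_finsetSum _ hi, add_comm |a|, add_pow, Finset.mul_sum]
  refine Finset.sum_le_sum fun m hm => ?_
  rw [integral_const_mul]
  obtain ⟨h0, h1⟩ := aux_mom_bd t m (by simpa [Nat.lt_succ_iff] using hm)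
  calc _ ≤ (s ^ m * |a| ^ (2 * t - m) * ((2 * t).choose m : ℝ)) * ∫ x, x ^ m ∂(gaussianReal 0 1) := by
        have hp : a ^ (2 * t - m) ≤ |a| ^ (2 * t - m) := by
          rw [← abs_pow]; exact le_abs_self _
        refine mul_le_mul_of_nonneg_right ?_ h0
        refine mul_le_mul_of_nonneg_right ?_ (by positivity)
        exact mul_le_mul_of_nonneg_left hp (by positivity)
    _ ≤ (s ^ m * |a| ^ (2 * t - m) * ((2 * t).choose m : ℝ)) * dfac t := by gcongr
    _ = _ := by ring

lemma aux_law {d : ℕ} (w : EuclideanSpace ℝ (Fin d)) :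
    (_root_.stdGaussian d).map (fun z => ⟪w, z⟫) = (gaussianReal 0 1).map (fun x => ‖w‖ * x) := by
  have e : _root_.stdGaussian d = ProbabilityTheory.stdGaussian (EuclideanSpace ℝ (Fin d)) :=
    map_pi_eq_stdGaussian
  rw [e]
  have h := IsGaussian.map_eq_gaussianReal
    (μ := ProbabilityTheory.stdGaussian (EuclideanSpace ℝ (Fin d))) (innerSL ℝ w)
  rw [variance_dual_stdGaussian, integral_strongDual_stdGaussian, innerSL_apply_norm] at h
  rw [gaussianReal_map_const_mul]
  refine Eq.trans h ?_
  congr 1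
  · simp
  · ext; simp

lemma aux_comp {d : ℕ} (μ u : EuclideanSpace ℝ (Fin d)) (S A : Matrix (Fin d) (Fin d) ℝ)
    (hA : A * Aᵀ = S) (t : ℕ) :
    Integrable (fun x => ⟪u, x⟫ ^ (2 * t)) (gaussianVec μ A) ∧
    ∫ x, ⟪u, x⟫ ^ (2 * t) ∂(gaussianVec μ A) ≤
      dfac t * (‖u‖ ^ (2 * t) * (‖μ‖ + Real.sqrt (specNorm S)) ^ (2 * t)) := by
  set w := Matrix.toEuclideanLin Aᵀ u with hw
  have hadj : ∀ z, ⟪u, Matrix.toEuclideanLin A z⟫ = ⟪w, z⟫ := by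
    intro z
    have := Matrix.toEuclideanLin_conjTranspose_eq_adjoint A
    rw [Matrix.conjTranspose_eq_transpose_of_trivial] at this
    rw [hw, this, LinearMap.adjoint_inner_left]
  have hwn : ‖w‖ ≤ ‖u‖ * Real.sqrt (specNorm S) := by
    have h1 : ‖w‖ ^ 2 ≤ ‖u‖ ^ 2 * specNorm S := by
      rw [← real_inner_self_eq_norm_sq, ← hadj]
      have : Matrix.toEuclideanLin A w = LinearMap.toContinuousLinearMap (Matrix.toEuclideanLin S) u := by
        rw [hw, ← hA]
        simp [Matrix.toLpLin_apply]
      rw [this]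
      refine (real_inner_le_norm _ _).trans ?_
      have := (LinearMap.toContinuousLinearMap (Matrix.toEuclideanLin S)).le_opNorm u
      calc _ ≤ ‖u‖ * (‖LinearMap.toContinuousLinearMap (Matrix.toEuclideanLin S)‖ * ‖u‖) := by gcongr
        _ = _ := by unfold specNorm; ring
    calc ‖w‖ = Real.sqrt (‖w‖ ^ 2) := by simp
      _ ≤ Real.sqrt (‖u‖ ^ 2 * specNorm S) := Real.sqrt_le_sqrt h1
      _ = _ := by rw [Real.sqrt_mul (by positivity)]; simp
  have hm : Measurable (fun z => μ + Matrix.toEuclideanLin A z) := by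
    have : Continuous (Matrix.toEuclideanLin A) := LinearMap.continuous_of_finiteDimensional _
    exact (continuous_const.add this).measurable
  have hg : AEStronglyMeasurable (fun y : ℝ => (⟪u, μ⟫ + y) ^ (2 * t))
    ((_root_.stdGaussian d).map (fun z => ⟪w, z⟫)) := by fun_prop
  have hg' : AEStronglyMeasurable (fun y : ℝ => (⟪u, μ⟫ + y) ^ (2 * t))
    ((gaussianReal 0 1).map (fun x => ‖w‖ * x)) := by fun_prop
  have hf : AEStronglyMeasurable (fun x => ⟪u, x⟫ ^ (2 * t))
    ((_root_.stdGaussian d).map (fun z => μ + Matrix.toEuclideanLin A z)) := by fun_prop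
  have hwm : AEMeasurable (fun z => ⟪w, z⟫) (_root_.stdGaussian d) := by fun_prop
  have hsm : AEMeasurable (fun x : ℝ => ‖w‖ * x) (gaussianReal 0 1) := by fun_prop
  have e : ((fun x => ⟪u, x⟫ ^ (2 * t)) ∘ fun z => μ + Matrix.toEuclideanLin A z) =
      (fun y : ℝ => (⟪u, μ⟫ + y) ^ (2 * t)) ∘ (fun z => ⟪w, z⟫) := by
    ext z; simp [inner_add_right, hadj]
  obtain ⟨i1, i2⟩ := aux_1d ⟪u, μ⟫ ‖w‖ (norm_nonneg _) t
  unfold gaussianVec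
  constructor
  · rw [integrable_map_measure hf hm.aemeasurable, e, ← integrable_map_measure hg hwm, aux_law,
      integrable_map_measure hg' hsm]
    exact i1
  · rw [integral_map hm.aemeasurable hf]
    have e2 : ∀ z, ⟪u, μ + Matrix.toEuclideanLin A z⟫ ^ (2 * t) =
      (fun y : ℝ => (⟪u, μ⟫ + y) ^ (2 * t)) ⟪w, z⟫ := congrFun e
    simp_rw [e2]
    rw [← integral_map hwm hg, aux_law, integral_map hsm hg']
    refine i2.trans ?_
    have := dfac_pos t
    rw [← mul_pow]
    gcongr
    rw [mul_add]
    exact add_le_add (abs_real_inner_le_norm _ _) hwn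

theorem stmt_13 {d L : ℕ} (hd : 1 ≤ d) (hL : 1 ≤ L)
    (lam : Fin L → ℝ) (hlam : ∀ l, lam l ∈ Set.Ioo (0 : ℝ) 1) (hsum : ∑ l, lam l = 1)
    (μ : Fin L → EuclideanSpace ℝ (Fin d))
    (S A : Fin L → Matrix (Fin d) (Fin d) ℝ)
    (hS : ∀ l, (S l).PosSemidef) (hA : ∀ l, A l * (A l)ᵀ = S l)
    (u : EuclideanSpace ℝ (Fin d)) (t : ℕ) (ht : 1 ≤ t) :
    (∫ x, ⟪u, x⟫ ^ (2 * t) ∂(gaussianMixture lam μ A)) ≤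
      ((2 * t).factorial : ℝ) / (2 ^ t * (t.factorial : ℝ)) * ‖u‖ ^ (2 * t) *
        ∑ l, lam l * (‖μ l‖ + Real.sqrt (specNorm (S l))) ^ (2 * t) := by
  have hc := fun l => aux_comp (μ l) u (S l) (A l) (hA l) t
  unfold gaussianMixture
  rw [integral_finsetSum_measure fun l _ => (hc l).1.smul_measure ENNReal.ofReal_ne_top]
  rw [Finset.mul_sum]
  refine Finset.sum_le_sum fun l _ => ?_
  rw [integral_smul_measure, ENNReal.toReal_ofReal (hlam l).1.le, smul_eq_mul]
  refine (mul_le_mul_of_nonneg_left (hc l).2 (hlam l).1.le).trans (le_of_eq ?_)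
  unfold dfac
  ring
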